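/- arXiv:2510.23486 — 8 statements merged into one kernel-verified Lean document; each statement's English description precedes it below -/
import Mathlib

section
/- There exist γ' ∈ [0,1) and a nonempty subset S ⊆ Π such that for every γ with γ' < γ < 1, the set of γ-discount-optimal policies {π ∈ Π : ∀ π' ∈ Π, J γ π ≥ J γ π'} equals S. (Existence of a Blackwell-optimal set for a finite policy class.) -/
open Filter Topology in
/-- A real polynomial is eventually of constant weak sign to the left of any point. -/
theorem Polynomial.eventually_nonneg_or_eventually_neg_nhdsLT (p : Polynomial ℝ) (a : ℝ) :
    (∀ᶠ x in 𝓝[<] a, 0 ≤ p.eval x) ∨ ∀ᶠ x in 𝓝[<] a, p.eval x < 0 := by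
  rcases eq_or_ne p 0 with rfl | hp
  · simp
  obtain ⟨q, hpq, hq⟩ := p.exists_eq_pow_rootMultiplicity_mul_and_not_dvd hp a
  set k := p.rootMultiplicity a
  have hqa : (-1) ^ k * q.eval a ≠ 0 :=
    mul_ne_zero (pow_ne_zero _ (by norm_num)) fun h => hq (Polynomial.dvd_iff_isRoot.2 h)
  have hpx (x : ℝ) : p.eval x = (a - x) ^ k * ((-1) ^ k * q.eval x) := by
    rw [hpq, ← mul_assoc, ← mul_pow]
    simp
  have hcont : Tendsto (fun x => (-1) ^ k * q.eval x) (𝓝[<] a) (𝓝 ((-1) ^ k * q.eval a)) :=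
    ((continuous_const.mul q.continuous).tendsto a).mono_left nhdsWithin_le_nhds
  rcases hqa.lt_or_gt with h | h
  · right
    filter_upwards [hcont.eventually_lt_const h, self_mem_nhdsWithin] with x hx hxa
    rw [hpx]
    exact mul_neg_of_pos_of_neg (pow_pos (sub_pos.2 hxa) k) hx
  · left
    filter_upwards [hcont.eventually_const_lt h, self_mem_nhdsWithin] with x hx hxa
    rw [hpx]
    exact mul_nonneg (pow_nonneg (sub_pos.2 hxa).le k) hx.le

/-- For a finite policy class, there exist `γ' ∈ [0,1)` and a nonempty
set `S ⊆ Π` such that for all `γ ∈ (γ', 1)`, the set of `γ`-discount-optimal policies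
equals `S` (existence of a Blackwell-optimal set). -/
theorem stmt1
    (P : Type*) [Fintype P] [Nonempty P]
    (H : ℕ) (hH : 0 < H)
    (c : P → Fin H → ℝ)
    (J : ℝ → P → ℝ)
    (hJ : ∀ γ π, J γ π = ∑ t : Fin H, γ ^ (t : ℕ) * c π t) :
    ∃ γ' : ℝ, 0 ≤ γ' ∧ γ' < 1 ∧ ∃ S : Set P, S.Nonempty ∧
      ∀ γ : ℝ, γ' < γ → γ < 1 →
        {π : P | ∀ π' : P, J γ π ≥ J γ π'} = S := by
  have hsign (π π' : P) : ∀ᶠ γ in nhdsWithin 1 (Set.Iio 1),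
      (J γ π ≥ J γ π' ↔ ∀ᶠ γ in nhdsWithin (1 : ℝ) (Set.Iio 1), J γ π ≥ J γ π') := by
    let p : Polynomial ℝ := ∑ t : Fin H, Polynomial.X ^ (t : ℕ) * Polynomial.C (c π t - c π' t)
    have hp (γ : ℝ) : p.eval γ = J γ π - J γ π' := by
      simp only [p, hJ, Polynomial.eval_finsetSum, Polynomial.eval_mul, Polynomial.eval_pow,
        Polynomial.eval_X, Polynomial.eval_C, mul_sub, Finset.sum_sub_distrib]
    rcases p.eventually_nonneg_or_eventually_neg_nhdsLT 1 with h | h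
    · simp only [hp, sub_nonneg] at h
      filter_upwards [h] with γ hγ using iff_of_true hγ h
    · simp only [hp, sub_neg] at h
      filter_upwards [h] with γ hγ
      refine iff_of_false hγ.not_ge fun h' => ?_
      obtain ⟨x, hx, hx'⟩ := (h.and h').exists
      exact hx.not_ge hx'
  have hall := Filter.eventually_all.2 fun π => Filter.eventually_all.2 (hsign π)
  refine (mem_nhdsLT_iff_exists_Ioo_subset.1 hall).elim fun l hl => ?_
  refine ⟨max 0 l, le_max_left _ _, max_lt one_pos hl.1,
    {π | ∀ π', ∀ᶠ γ in nhdsWithin (1 : ℝ) (Set.Iio 1), J γ π ≥ J γ π'}, ?_, ?_⟩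
  · obtain ⟨γ, hγ⟩ := hall.exists
    obtain ⟨π, hπ⟩ := Finite.exists_max (J γ)
    exact ⟨π, fun π' => (hγ π π').1 (hπ π')⟩
  · intro γ hγ hγ1
    ext π
    exact forall_congr' (hl.2 ⟨(le_max_right _ _).trans_lt hγ, hγ1⟩ π)
end

section
/- There exists a nonempty subset S ⊆ Π such that the set G = {γ ∈ [0,1) : for all γ' with γ < γ' < 1, Π*_{γ'} = S} is nonempty, and the Blackwell discount factor γ_bw := inf G satisfies 0 ≤ γ_bw < 1. (Existence of the Blackwell discount factor for a finite policy class.) -/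
open Filter Topology in
/-- A real polynomial has eventually constant sign to the left of a point. -/
theorem Polynomial.eventually_nhdsLT_eval_nonneg_or_neg (p : Polynomial ℝ) (a : ℝ) :
    (∀ᶠ x in 𝓝[<] a, 0 ≤ p.eval x) ∨ (∀ᶠ x in 𝓝[<] a, p.eval x < 0) := by
  by_cases hp : p = 0
  · simp [hp]
  obtain ⟨q, hq, hdvd⟩ := p.exists_eq_pow_rootMultiplicity_mul_and_not_dvd hp a
  generalize p.rootMultiplicity a = n at hq
  have hqa : q.eval a ≠ 0 := fun h => hdvd (Polynomial.dvd_iff_isRoot.mpr h)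
  have heval (x : ℝ) : p.eval x = (x - a) ^ n * q.eval x := by
    simp [hq]
  have hlt : ∀ᶠ x in 𝓝[<] a, x - a < 0 := by
    filter_upwards [self_mem_nhdsWithin] with x hx using sub_neg.mpr hx
  have hcont : Tendsto (fun x => q.eval x) (𝓝[<] a) (𝓝 (q.eval a)) :=
    q.continuous.continuousAt.continuousWithinAt
  simp only [heval]
  rcases hqa.lt_or_gt with h | h <;> rcases n.even_or_odd with hn | hn
  · right
    filter_upwards [hlt, hcont.eventually_lt_const h] with x hx hqx
    exact mul_neg_of_pos_of_neg (hn.pow_pos hx.ne) hqx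
  · left
    filter_upwards [hlt, hcont.eventually_lt_const h] with x hx hqx
    exact (mul_pos_of_neg_of_neg (hn.pow_neg hx) hqx).le
  · left
    filter_upwards [hlt, hcont.eventually_const_lt h] with x hx hqx
    exact (mul_pos (hn.pow_pos hx.ne) hqx).le
  · right
    filter_upwards [hlt, hcont.eventually_const_lt h] with x hx hqx
    exact mul_neg_of_neg_of_pos (hn.pow_neg hx) hqx

/-- For a finite policy class, there is a nonempty set `S ⊆ Π` such that
the set `G = {γ ∈ [0,1) : Π*_{γ'} = S for all γ' ∈ (γ,1)}` is nonempty, and the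
Blackwell discount factor `γ_bw = inf G` satisfies `0 ≤ γ_bw < 1`. -/
theorem stmt2
    (P : Type*) [Fintype P] [Nonempty P]
    (H : ℕ) (hH : 0 < H)
    (c : P → Fin H → ℝ)
    (J : ℝ → P → ℝ)
    (hJ : ∀ γ π, J γ π = ∑ t : Fin H, γ ^ (t : ℕ) * c π t)
    (Opt : ℝ → Set P)
    (hOpt : ∀ γ, Opt γ = {π : P | ∀ π' : P, J γ π ≥ J γ π'}) :
    ∃ S : Set P, S.Nonempty ∧
      {γ : ℝ | 0 ≤ γ ∧ γ < 1 ∧ ∀ γ' : ℝ, γ < γ' → γ' < 1 → Opt γ' = S}.Nonempty ∧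
      0 ≤ sInf {γ : ℝ | 0 ≤ γ ∧ γ < 1 ∧ ∀ γ' : ℝ, γ < γ' → γ' < 1 → Opt γ' = S} ∧
      sInf {γ : ℝ | 0 ≤ γ ∧ γ < 1 ∧ ∀ γ' : ℝ, γ < γ' → γ' < 1 → Opt γ' = S} < 1 := by
  open Filter Topology in
  have hsign (π π' : P) : (∀ᶠ γ in 𝓝[<] (1 : ℝ), J γ π' ≤ J γ π) ∨
      (∀ᶠ γ in 𝓝[<] (1 : ℝ), J γ π < J γ π') := by
    have heval (γ : ℝ) : (∑ t : Fin H, Polynomial.C (c π t - c π' t) *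
        Polynomial.X ^ (t : ℕ)).eval γ = J γ π - J γ π' := by
      simp only [hJ, Polynomial.eval_finsetSum, ← Finset.sum_sub_distrib, Polynomial.eval_mul,
        Polynomial.eval_C, Polynomial.eval_pow, Polynomial.eval_X]
      exact Finset.sum_congr rfl fun t _ => by ring
    have h := Polynomial.eventually_nhdsLT_eval_nonneg_or_neg
      (∑ t : Fin H, Polynomial.C (c π t - c π' t) * Polynomial.X ^ (t : ℕ)) 1
    simp only [heval, sub_nonneg, sub_neg] at h
    exact h
  open Filter Topology in
  obtain ⟨S, hS⟩ : ∃ S : Set P, ∀ᶠ γ in 𝓝[<] (1 : ℝ), Opt γ = S := by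
    refine ⟨{π | ∀ π', ∀ᶠ γ in 𝓝[<] (1 : ℝ), J γ π' ≤ J γ π}, ?_⟩
    have hpair (π π' : P) : ∀ᶠ γ in 𝓝[<] (1 : ℝ),
        (J γ π' ≤ J γ π ↔ ∀ᶠ γ in 𝓝[<] (1 : ℝ), J γ π' ≤ J γ π) := by
      rcases hsign π π' with h | h
      · filter_upwards [h] with γ hγ using iff_of_true hγ h
      · filter_upwards [h] with γ hγ
        refine iff_of_false hγ.not_ge fun h' => ?_
        obtain ⟨x, hx, hx'⟩ := (h.and h').exists
        exact hx.not_ge hx'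
    filter_upwards [eventually_all.mpr fun π => eventually_all.mpr (hpair π)] with γ hγ
    ext π
    simp only [hOpt, Set.mem_ofPred_eq, ge_iff_le]
    exact forall_congr' (hγ π)
  obtain ⟨l, hl, hlS⟩ := (mem_nhdsLT_iff_exists_Ioo_subset' (zero_lt_one' ℝ)).mp hS
  have hmem : max 0 l ∈
      {γ : ℝ | 0 ≤ γ ∧ γ < 1 ∧ ∀ γ' : ℝ, γ < γ' → γ' < 1 → Opt γ' = S} :=
    ⟨le_max_left _ _, max_lt one_pos hl,
      fun γ' h h' => hlS ⟨(le_max_right _ _).trans_lt h, h'⟩⟩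
  refine ⟨S, ?_, ⟨_, hmem⟩, Real.sInf_nonneg fun γ hγ => hγ.1,
    (csInf_le ⟨0, fun γ hγ => hγ.1⟩ hmem).trans_lt hmem.2.1⟩
  obtain ⟨γ, hγ⟩ := hS.exists
  obtain ⟨π, hπ⟩ := Finite.exists_max (J γ)
  exact ⟨π, by rw [← hγ, hOpt]; exact hπ⟩
end

section
/- If π ∈ Π is Blackwell optimal, i.e. there exists γ₀ ∈ [0,1) such that J γ π ≥ J γ π' for every π' ∈ Π and every γ with γ₀ ≤ γ < 1, then π is also optimal for the undiscounted problem: J 1 π ≥ J 1 π' for every π' ∈ Π. -/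
/-- If `π` is Blackwell optimal (optimal for all discount factors in
`[γ₀, 1)` for some `γ₀ ∈ [0,1)`), then `π` is optimal for the undiscounted
(`γ = 1`) problem. -/
theorem stmt3
    (P : Type*) [Fintype P] [Nonempty P]
    (H : ℕ) (hH : 0 < H)
    (c : P → Fin H → ℝ)
    (J : ℝ → P → ℝ)
    (hJ : ∀ γ π, J γ π = ∑ t : Fin H, γ ^ (t : ℕ) * c π t)
    (π : P)
    (hbw : ∃ γ₀ : ℝ, 0 ≤ γ₀ ∧ γ₀ < 1 ∧
      ∀ γ : ℝ, γ₀ ≤ γ → γ < 1 → ∀ π' : P, J γ π ≥ J γ π') :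
    ∀ π' : P, J 1 π ≥ J 1 π' := by
  obtain ⟨γ₀, -, hγ₀, hopt⟩ := hbw
  intro π'
  have hcont : ∀ ρ : P, Filter.Tendsto (fun γ => J γ ρ) (nhdsWithin 1 (Set.Iio 1))
      (nhds (J 1 ρ)) := by
    intro ρ
    have h : Continuous fun γ => J γ ρ := by
      simp only [hJ]
      fun_prop
    exact h.continuousAt.continuousWithinAt
  refine le_of_tendsto_of_tendsto (hcont π') (hcont π) ?_
  filter_upwards [Ico_mem_nhdsLT hγ₀] with γ hγ
  exact hopt γ hγ.1 hγ.2 π'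
end

section
/- For all π, π' ∈ Π: if the function γ ↦ J γ π − J γ π' is not identically zero on [0,1), then every γ ∈ [0,1) satisfying J γ π = J γ π' obeys γ < 1 − η_μ. In particular, with γ_μ(π,π') defined as the largest γ ∈ [0,1) at which J γ π = J γ π' (set to 0 when no such γ exists or the difference is identically zero on [0,1)), one has max over π, π' ∈ Π of γ_μ(π,π') < 1 − η_μ. (μ-weighted bound on the Blackwell discount factor.) -/
open Matrix

/-- The `ℓ¹` norm of the coefficient vector of an integer polynomial. -/
def coeffNorm (p : Polynomial ℤ) : ℤ := p.sum fun _ a => |a|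

namespace coeffNorm

open Polynomial

lemma eq_sum_range (p : ℤ[X]) {n : ℕ} (h : p.natDegree < n) :
    coeffNorm p = ∑ i ∈ Finset.range n, |p.coeff i| :=
  p.sum_over_range' (fun _ => abs_zero) n h

lemma nonneg (p : ℤ[X]) : 0 ≤ coeffNorm p :=
  Finset.sum_nonneg fun _ _ => abs_nonneg _

lemma add_le (p q : ℤ[X]) : coeffNorm (p + q) ≤ coeffNorm p + coeffNorm q := by
  have hp : p.natDegree < max p.natDegree q.natDegree + 1 := by omega
  have hq : q.natDegree < max p.natDegree q.natDegree + 1 := by omega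
  have hpq : (p + q).natDegree < max p.natDegree q.natDegree + 1 :=
    Nat.lt_succ_of_le (natDegree_add_le p q)
  rw [eq_sum_range _ hp, eq_sum_range _ hq, eq_sum_range _ hpq, ← Finset.sum_add_distrib]
  exact Finset.sum_le_sum fun i _ => by rw [coeff_add]; exact abs_add_le _ _

lemma neg (p : ℤ[X]) : coeffNorm (-p) = coeffNorm p := by
  simp [coeffNorm, Polynomial.sum]

lemma sub_le (p q : ℤ[X]) : coeffNorm (p - q) ≤ coeffNorm p + coeffNorm q := by
  rw [sub_eq_add_neg, ← neg q]
  exact add_le _ _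

lemma zero : coeffNorm 0 = 0 := by simp [coeffNorm]

lemma monomial (n : ℕ) (a : ℤ) : coeffNorm (Polynomial.monomial n a) = |a| :=
  sum_monomial_index a _ abs_zero

lemma C (a : ℤ) : coeffNorm (Polynomial.C a) = |a| := monomial 0 a

lemma sum_le {ι : Type*} (s : Finset ι) (f : ι → ℤ[X]) :
    coeffNorm (∑ i ∈ s, f i) ≤ ∑ i ∈ s, coeffNorm (f i) :=
  Finset.le_sum_of_subadditive coeffNorm zero.le add_le s f

lemma mul_le (p q : ℤ[X]) : coeffNorm (p * q) ≤ coeffNorm p * coeffNorm q := by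
  rw [mul_eq_sum_sum]
  refine (sum_le _ _).trans ?_
  rw [coeffNorm, Polynomial.sum, Finset.sum_mul]
  refine Finset.sum_le_sum fun i _ => (sum_le _ _).trans ?_
  rw [coeffNorm, Polynomial.sum, Finset.mul_sum]
  exact Finset.sum_le_sum fun j _ => by rw [monomial, abs_mul]

lemma prod_le_pow {ι : Type*} (s : Finset ι) (f : ι → ℤ[X]) {b : ℤ}
    (hf : ∀ i ∈ s, coeffNorm (f i) ≤ b) : coeffNorm (∏ i ∈ s, f i) ≤ b ^ s.card := by
  classical
  induction s using Finset.induction_on with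
  | empty => simpa using (C 1).le
  | insert a s ha ih =>
    rw [Finset.prod_insert ha, Finset.card_insert_of_notMem ha, pow_succ']
    have hb := hf a (Finset.mem_insert_self a s)
    exact (mul_le _ _).trans (mul_le_mul hb (ih fun i hi => hf i (Finset.mem_insert_of_mem hi))
      (nonneg _) ((nonneg _).trans hb))

lemma det_le {S : Type*} [Fintype S] [DecidableEq S] (M : Matrix S S ℤ[X]) {b : ℤ}
    (hM : ∀ i j, coeffNorm (M i j) ≤ b) :
    coeffNorm M.det ≤ (Fintype.card S).factorial * b ^ Fintype.card S := by
  rw [det_apply]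
  refine (sum_le _ _).trans ?_
  have hσ : ∀ σ ∈ (Finset.univ : Finset (Equiv.Perm S)),
      coeffNorm (Equiv.Perm.sign σ • ∏ i, M (σ i) i) ≤ b ^ Fintype.card S := by
    intro σ _
    have h := prod_le_pow Finset.univ (fun i => M (σ i) i) fun i _ => hM (σ i) i
    rcases Int.units_eq_one_or (Equiv.Perm.sign σ) with h1 | h1
    · simpa [h1] using h
    · simpa [h1, neg] using h
  simpa [Fintype.card_perm] using Finset.sum_le_card_nsmul _ _ _ hσ

lemma adjugate_le {S : Type*} [Fintype S] [DecidableEq S] (M : Matrix S S ℤ[X]) {b : ℤ}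
    (hb : 1 ≤ b) (hM : ∀ i j, coeffNorm (M i j) ≤ b) (i j : S) :
    coeffNorm (M.adjugate i j) ≤ (Fintype.card S).factorial * b ^ Fintype.card S := by
  rw [adjugate_apply]
  refine det_le _ fun k l => ?_
  rw [updateRow_apply]
  split_ifs
  · rw [Pi.single_apply]
    split_ifs
    · simpa using (C 1).le.trans hb
    · exact zero.le.trans (by linarith)
  · exact hM k l

/-- A root of a nonzero integer polynomial in `(0, 1]` is at least the reciprocal of its
coefficient norm. -/
lemma one_le_root_mul {f : ℤ[X]} (hf : f ≠ 0) {x : ℝ} (hx0 : 0 < x) (hx1 : x ≤ 1)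
    (hroot : aeval x f = 0) : 1 ≤ x * (coeffNorm f : ℝ) := by
  set k := f.natTrailingDegree with hk
  have hmem : k ∈ f.support := natTrailingDegree_mem_support_of_nonzero hf
  have hcoeff : (1 : ℝ) ≤ |(f.coeff k : ℝ)| := by
    exact_mod_cast Int.one_le_abs (mem_support_iff.mp hmem)
  rw [aeval_def, eval₂_eq_sum, Polynomial.sum, ← Finset.add_sum_erase _ _ hmem,
    add_eq_zero_iff_eq_neg] at hroot
  have hrest : |∑ i ∈ f.support.erase k, (algebraMap ℤ ℝ) (f.coeff i) * x ^ i|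
      ≤ x ^ (k + 1) * (coeffNorm f : ℝ) := by
    calc _ ≤ ∑ i ∈ f.support.erase k, x ^ (k + 1) * |(f.coeff i : ℝ)| := by
          refine (Finset.abs_sum_le_sum_abs _ _).trans (Finset.sum_le_sum fun i hi => ?_)
          obtain ⟨hne, hi⟩ := Finset.mem_erase.mp hi
          have hki : k ≤ i := natTrailingDegree_le_of_mem_supp i hi
          rw [abs_mul, abs_of_nonneg (pow_nonneg hx0.le i), mul_comm]
          exact mul_le_mul_of_nonneg_right (pow_le_pow_of_le_one hx0.le hx1 (by omega))
            (abs_nonneg _)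
      _ ≤ ∑ i ∈ f.support, x ^ (k + 1) * |(f.coeff i : ℝ)| :=
          Finset.sum_le_sum_of_subset_of_nonneg (Finset.erase_subset _ _)
            fun _ _ _ => by positivity
      _ = x ^ (k + 1) * (coeffNorm f : ℝ) := by
          rw [← Finset.mul_sum, coeffNorm, Polynomial.sum]
          push_cast
          rfl
  rw [← abs_neg, ← hroot, abs_mul, abs_of_nonneg (pow_nonneg hx0.le k), pow_succ] at hrest
  have hxk : 0 < x ^ k := pow_pos hx0 k
  have h : x ^ k * 1 ≤ x ^ k * (x * (coeffNorm f : ℝ)) := by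
    calc x ^ k * 1 ≤ x ^ k * |(f.coeff k : ℝ)| := by gcongr
      _ ≤ _ := by
        rw [mul_comm, ← mul_assoc]
        exact hrest
  exact le_of_mul_le_mul_left h hxk

end coeffNorm

lemma det_one_sub_smul_ne_zero {S : Type*} [Fintype S] [DecidableEq S] {A : Matrix S S ℝ}
    (hA : ∀ i j, 0 ≤ A i j) (hrow : ∀ i, ∑ j, A i j = 1) {γ : ℝ} (h0 : 0 ≤ γ) (h1 : γ < 1) :
    (1 - γ • A).det ≠ 0 := by
  refine det_ne_zero_of_sum_row_lt_diag fun k => ?_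
  have hoff : ∑ j ∈ Finset.univ.erase k, ‖(1 - γ • A) k j‖
      = γ * ∑ j ∈ Finset.univ.erase k, A k j := by
    rw [Finset.mul_sum]
    refine Finset.sum_congr rfl fun j hj => ?_
    rw [Matrix.sub_apply, one_apply_ne (Finset.ne_of_mem_erase hj).symm, zero_sub, norm_neg, Matrix.smul_apply,
      smul_eq_mul, Real.norm_of_nonneg (mul_nonneg h0 (hA k j))]
  have hsum : A k k + ∑ j ∈ Finset.univ.erase k, A k j = 1 := by
    rw [Finset.add_sum_erase _ _ (Finset.mem_univ k), hrow]
  rw [hoff, Matrix.sub_apply, one_apply_eq, Matrix.smul_apply, smul_eq_mul]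
  refine lt_of_lt_of_le ?_ (le_abs_self _)
  linear_combination h1 + γ * hsum

/-- The discounted return of a rational Markov reward process, as a function of `1 - γ`, is a
quotient of integer polynomials with controlled coefficients. -/
lemma exists_polynomial_discounted_return {S : Type*} [Fintype S] [DecidableEq S]
    {A : Matrix S S ℝ} {r μ : S → ℝ} (hA : ∀ i j, 0 ≤ A i j) (hrow : ∀ i, ∑ j, A i j = 1)
    {m b D : ℕ} (hm : 0 < m) {n : S → S → ℤ} (hn0 : ∀ i j, 0 ≤ n i j) (hnm : ∀ i j, n i j ≤ m)
    (hAn : ∀ i j, A i j = n i j / m) {w : S → ℤ} (hwb : ∀ i, |w i| ≤ b)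
    (hrw : ∀ i, r i = w i / m) {z : S → ℤ} (hz0 : ∀ i, 0 ≤ z i) (hzD : ∑ i, z i = D)
    (hμz : ∀ i, D * μ i = z i) :
    ∃ h d : Polynomial ℤ,
      coeffNorm h ≤ D * (Fintype.card S * b *
        ((Fintype.card S).factorial * (2 * m) ^ Fintype.card S)) ∧
      coeffNorm d ≤ (Fintype.card S).factorial * (2 * m) ^ Fintype.card S ∧
      ∀ γ : ℝ, 0 ≤ γ → γ < 1 → Polynomial.aeval (1 - γ) d ≠ 0 ∧
        D * (μ ⬝ᵥ ((1 - γ • A)⁻¹ *ᵥ r)) * Polynomial.aeval (1 - γ) d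
          = Polynomial.aeval (1 - γ) h := by
  set M : Matrix S S (Polynomial ℤ) := Matrix.of fun i j =>
    Polynomial.C ((if i = j then (m : ℤ) else 0) - n i j) + Polynomial.monomial 1 (n i j) with hMdef
  have hM : ∀ i j, coeffNorm (M i j) ≤ 2 * m := by
    intro i j
    rw [hMdef, of_apply]
    refine (coeffNorm.add_le _ _).trans ?_
    rw [coeffNorm.C, coeffNorm.monomial, abs_of_nonneg (hn0 i j)]
    have h0 := hn0 i j
    have h1 := hnm i j
    split_ifs
    · rw [abs_of_nonneg (by linarith)]; linarith
    · rw [zero_sub, abs_neg, abs_of_nonneg h0]; linarith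
  have hm1 : (1 : ℤ) ≤ 2 * m := by omega
  have hmR : (m : ℝ) ≠ 0 := by positivity
  refine ⟨∑ i, Polynomial.C (z i) * ∑ j, M.adjugate i j * Polynomial.C (w j), M.det, ?_,
    coeffNorm.det_le M hM, fun γ h0 h1 => ?_⟩
  · refine (coeffNorm.sum_le _ _).trans ?_
    rw [← hzD, Finset.sum_mul]
    refine Finset.sum_le_sum fun i _ => (coeffNorm.mul_le _ _).trans ?_
    rw [coeffNorm.C, abs_of_nonneg (hz0 i)]
    refine mul_le_mul_of_nonneg_left ((coeffNorm.sum_le _ _).trans ?_) (hz0 i)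
    have hj : ∀ j ∈ Finset.univ, coeffNorm (M.adjugate i j * Polynomial.C (w j))
        ≤ (Fintype.card S).factorial * (2 * m) ^ Fintype.card S * (b : ℤ) := fun j _ =>
      (coeffNorm.mul_le _ _).trans (mul_le_mul (coeffNorm.adjugate_le M hm1 hM i j)
        ((coeffNorm.C _).le.trans (hwb j)) (coeffNorm.nonneg _) (by positivity))
    refine (Finset.sum_le_card_nsmul _ _ _ hj).trans (le_of_eq ?_)
    rw [Finset.card_univ, nsmul_eq_mul]
    ring
  · set φ : Polynomial ℤ →ₐ[ℤ] ℝ := Polynomial.aeval (1 - γ) with hφ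
    have hφM : φ.mapMatrix M = (m : ℝ) • (1 - γ • A) := by
      ext i j
      simp only [hMdef, AlgHom.mapMatrix_apply, map_apply, of_apply, map_add, hφ,
        Polynomial.aeval_C, Polynomial.aeval_monomial, Matrix.smul_apply, Matrix.sub_apply,
        one_apply, smul_eq_mul, hAn, pow_one, algebraMap_int_eq, Int.coe_castRingHom, Int.cast_sub]
      split_ifs <;> field_simp <;> push_cast <;> ring
    have hdetA := det_one_sub_smul_ne_zero hA hrow h0 h1
    have hdet : φ M.det ≠ 0 := by
      rw [AlgHom.map_det, hφM, det_smul]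
      exact mul_ne_zero (pow_ne_zero _ hmR) hdetA
    refine ⟨hdet, ?_⟩
    have hw : (fun i => (w i : ℝ)) = φ.mapMatrix M *ᵥ ((1 - γ • A)⁻¹ *ᵥ r) := by
      rw [hφM, smul_mulVec, mulVec_mulVec, mul_nonsing_inv _ (isUnit_iff_ne_zero.mpr hdetA),
        one_mulVec]
      ext i
      simp only [Pi.smul_apply, smul_eq_mul, hrw]
      field_simp
    have hcancel : φ.mapMatrix M.adjugate *ᵥ (fun i => (w i : ℝ))
        = φ M.det • ((1 - γ • A)⁻¹ *ᵥ r) := by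
      rw [hw, mulVec_mulVec, AlgHom.map_adjugate, adjugate_mul, smul_mulVec, one_mulVec,
        AlgHom.map_det]
    have hsum : ∀ i, φ (Polynomial.C (z i) * ∑ j, M.adjugate i j * Polynomial.C (w j))
        = D * μ i * (φ M.det * ((1 - γ • A)⁻¹ *ᵥ r) i) := by
      intro i
      have hi := congrFun hcancel i
      simp only [mulVec, dotProduct, AlgHom.mapMatrix_apply, map_apply, Pi.smul_apply,
        smul_eq_mul] at hi
      rw [map_mul, map_sum, hμz, mulVec, dotProduct, ← hi, hφ]
      simp
    rw [map_sum, Finset.sum_congr rfl fun i _ => hsum i, dotProduct, Finset.mul_sum,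
      Finset.sum_mul]
    exact Finset.sum_congr rfl fun i _ => by ring

lemma factorial_succ_le_pow (n : ℕ) : (n + 1).factorial ≤ (n + 1) ^ n := by
  induction n with
  | zero => simp
  | succ n ih =>
    rw [Nat.factorial_succ, pow_succ']
    exact Nat.mul_le_mul_left _ (ih.trans (Nat.pow_le_pow_left (Nat.le_succ _) n))

lemma mul_factorial_sq_lt_pow {n L : ℕ} (hn : 0 < n) (hL : n ≤ L) :
    L * n.factorial ^ 2 < (L + 1) ^ (2 * n - 1) := by
  obtain ⟨k, rfl⟩ := Nat.exists_eq_succ_of_ne_zero hn.ne'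
  have h : (k + 1).factorial ^ 2 ≤ ((L + 1) ^ k) ^ 2 :=
    Nat.pow_le_pow_left
      ((factorial_succ_le_pow k).trans (Nat.pow_le_pow_left (by omega) k)) 2
  have hexp : 2 * (k + 1) - 1 = k * 2 + 1 := by omega
  rw [Nat.succ_eq_add_one, hexp, pow_succ' (L + 1), pow_mul]
  exact Nat.mul_lt_mul_of_lt_of_le (Nat.lt_succ_self L) h (by positivity)

/-- μ-weighted bound on the Blackwell discount factor. Under the
rationality assumption on the transition matrices and rewards, for any two policies
whose μ-weighted discounted returns do not agree identically on `[0,1)`, every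
`γ ∈ [0,1)` where the returns agree satisfies `γ < 1 − η_μ`. -/
theorem stmt4
    (S : Type*) [Fintype S] [Nonempty S] [DecidableEq S]
    (P : Type*) [Fintype P] [Nonempty P]
    (Pmat : P → Matrix S S ℝ) (r : P → S → ℝ)
    (hstoch : ∀ π s s', 0 ≤ Pmat π s s')
    (hrow : ∀ π s, ∑ s', Pmat π s s' = 1)
    (m : ℕ) (hm : 0 < m) (rinf : ℕ) (hrinf : 0 < rinf)
    (hPrat : ∀ π s s', ∃ n : ℤ, 0 ≤ n ∧ n ≤ (m : ℤ) ∧ Pmat π s s' = (n : ℝ) / m)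
    (hrrat : ∀ π s, ∃ w : ℤ, |w| ≤ (rinf : ℤ) ∧ r π s = (w : ℝ) / m)
    (μ : S → ℝ) (hμ0 : ∀ s, 0 ≤ μ s) (hμ1 : ∑ s, μ s = 1)
    (hμrat : ∀ s, ∃ q : ℚ, μ s = (q : ℝ))
    (D : ℕ) (hD : 0 < D)
    (hDint : ∀ s, ∃ z : ℤ, (D : ℝ) * μ s = (z : ℝ))
    (hDmin : ∀ D' : ℕ, 0 < D' → (∀ s, ∃ z : ℤ, (D' : ℝ) * μ s = (z : ℝ)) → D ≤ D')
    (J : ℝ → P → ℝ)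
    (hJ : ∀ γ : ℝ, 0 ≤ γ → γ < 1 → ∀ π : P,
      J γ π = μ ⬝ᵥ ((1 - γ • Pmat π)⁻¹ *ᵥ r π))
    (N : ℕ) (hN : N = 2 * Fintype.card S - 1)
    (L : ℕ)
    (hL : L = 2 * D * Fintype.card S * rinf * m ^ (2 * Fintype.card S) *
      4 ^ (Fintype.card S))
    (η : ℝ)
    (hη : η = 1 / (2 * (N : ℝ) ^ ((N : ℝ) / 2 + 2) * ((L : ℝ) + 1) ^ N)) :
    ∀ π π' : P,
      (∃ γ : ℝ, 0 ≤ γ ∧ γ < 1 ∧ J γ π ≠ J γ π') →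
      ∀ γ : ℝ, 0 ≤ γ → γ < 1 → J γ π = J γ π' → γ < 1 - η := by
  intro π π' ⟨γ₀, hγ₀0, hγ₀1, hne⟩ γ hγ0 hγ1 heq
  choose n hn0 hnm hPn using hPrat
  choose w hwb hrw using hrrat
  choose z hz using hDint
  have hDR : (0 : ℝ) < D := by exact_mod_cast hD
  have hz0 : ∀ s, 0 ≤ z s := fun s => by
    have h : (0 : ℝ) ≤ z s := hz s ▸ mul_nonneg hDR.le (hμ0 s)
    exact_mod_cast h
  have hzD : ∑ s, z s = D := by
    have h : ∑ s, (z s : ℝ) = D := by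
      simp_rw [← hz]
      rw [← Finset.mul_sum, hμ1, mul_one]
    exact_mod_cast h
  have hpoly := fun π => exists_polynomial_discounted_return (hstoch π) (hrow π) hm (hn0 π)
    (hnm π) (hPn π) (hwb π) (hrw π) hz0 hzD hz
  obtain ⟨h, d, hh, hd, hval⟩ := hpoly π
  obtain ⟨h', d', hh', hd', hval'⟩ := hpoly π'
  have hf : ∀ x : ℝ, 0 ≤ x → x < 1 →
      Polynomial.aeval (1 - x) (h * d' - h' * d) = D * (J x π - J x π') *
        (Polynomial.aeval (1 - x) d * Polynomial.aeval (1 - x) d') := by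
    intro x hx0 hx1
    rw [map_sub, map_mul, map_mul, ← (hval x hx0 hx1).2, ← (hval' x hx0 hx1).2,
      hJ x hx0 hx1, hJ x hx0 hx1]
    ring
  have hf0 : h * d' - h' * d ≠ 0 := by
    intro h0
    have h1 := hf γ₀ hγ₀0 hγ₀1
    rw [h0, map_zero] at h1
    exact mul_ne_zero (mul_ne_zero hDR.ne' (sub_ne_zero.mpr hne))
      (mul_ne_zero (hval γ₀ hγ₀0 hγ₀1).1 (hval' γ₀ hγ₀0 hγ₀1).1) h1.symm
  have hroot := coeffNorm.one_le_root_mul hf0 (sub_pos.mpr hγ1) (by linarith)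
    (by rw [hf γ hγ0 hγ1, heq]; ring)
  have hnorm : coeffNorm (h * d' - h' * d) ≤ (L * (Fintype.card S).factorial ^ 2 : ℕ) := by
    refine (coeffNorm.sub_le _ _).trans ((add_le_add
      ((coeffNorm.mul_le _ _).trans (mul_le_mul hh hd' (coeffNorm.nonneg _) (by positivity)))
      ((coeffNorm.mul_le _ _).trans
        (mul_le_mul hh' hd (coeffNorm.nonneg _) (by positivity)))).trans (le_of_eq ?_))
    have h4 : (4 : ℤ) ^ Fintype.card S = (2 ^ Fintype.card S) ^ 2 := by
      rw [← pow_mul, mul_comm, pow_mul]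
      norm_num
    rw [hL]
    push_cast
    rw [h4, mul_pow]
    ring
  have hcard : 0 < Fintype.card S := Fintype.card_pos
  have hcardL : Fintype.card S ≤ L := by
    rw [hL, show 2 * D * Fintype.card S * rinf * m ^ (2 * Fintype.card S) * 4 ^ Fintype.card S
      = Fintype.card S * (2 * D * rinf * m ^ (2 * Fintype.card S) * 4 ^ Fintype.card S) by ring]
    exact Nat.le_mul_of_pos_right _ (by positivity)
  have hlt : (coeffNorm (h * d' - h' * d) : ℝ) < ((L : ℝ) + 1) ^ N := by
    have h1 := mul_factorial_sq_lt_pow hcard hcardL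
    rw [← hN] at h1
    exact_mod_cast lt_of_le_of_lt hnorm (Int.ofNat_lt.mpr h1)
  have hN1 : (1 : ℝ) ≤ N := by
    have h1 : 1 ≤ N := by omega
    exact_mod_cast h1
  have hNpow : 1 ≤ (N : ℝ) ^ ((N : ℝ) / 2 + 2) := Real.one_le_rpow hN1 (by positivity)
  have hpow : (0 : ℝ) < ((L : ℝ) + 1) ^ N := by positivity
  have hden : ((L : ℝ) + 1) ^ N ≤ 2 * (N : ℝ) ^ ((N : ℝ) / 2 + 2) * ((L : ℝ) + 1) ^ N :=
    le_mul_of_one_le_left hpow.le (by linarith)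
  have hη1 : η < 1 - γ := by
    rw [hη, div_lt_iff₀ (hpow.trans_le hden)]
    exact hroot.trans_lt (mul_lt_mul_of_pos_left (hlt.trans_le hden) (sub_pos.mpr hγ1))
  linarith
end

section
/- Suppose π* ∈ Π is Blackwell optimal. Then π* is a shortest-path policy: (i) p π* ≥ p π for every π ∈ Π, i.e. π* maximizes the success probability; and (ii) if max_{π ∈ Π} p π > 0, then for every π ∈ Π with p π = p π*, one has L π* ≤ L π, i.e. among success-probability maximizers, π* minimizes the conditional successful-path length. -/
open Filter Topology in
/-- A function vanishing at `a` and nonnegative just to the left of `a` has nonpositive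
derivative there. -/
theorem HasDerivAt.nonpos_of_eventually_nonneg_left {f : ℝ → ℝ} {f' a : ℝ}
    (hf : HasDerivAt f f' a) (ha : f a = 0) (h : ∀ᶠ x in 𝓝[<] a, 0 ≤ f x) : f' ≤ 0 := by
  have hs : Tendsto (slope f a) (𝓝[<] a) (𝓝 f') :=
    (hasDerivAt_iff_tendsto_slope.1 hf).mono_left
      (nhdsWithin_mono _ fun x hx => ne_of_lt hx)
  refine le_of_tendsto hs ?_
  filter_upwards [h, self_mem_nhdsWithin] with x hx hxa
  rw [slope_def_field, ha, sub_zero]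
  exact div_nonpos_of_nonneg_of_nonpos hx (sub_nonpos.2 (le_of_lt hxa))

theorem hasDerivAt_sum_pow_mul_one {H : ℕ} (c : Fin H → ℝ) :
    HasDerivAt (fun γ : ℝ => ∑ t : Fin H, γ ^ (t : ℕ) * c t)
      (∑ t : Fin H, ((t : ℕ) : ℝ) * c t) 1 := by
  refine HasDerivAt.fun_sum fun t _ => ?_
  simpa using (hasDerivAt_pow (t : ℕ) (1 : ℝ)).mul_const (c t)

/-- In a finite-horizon deterministic verifier MDP with binary terminal
reward, every Blackwell-optimal policy is a shortest-path policy: it maximizes the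
success probability `p`, and, when the maximal success probability is positive, it
minimizes the conditional successful-path length `L` among success-probability
maximizers. -/
theorem stmt5
    (P : Type*) [Fintype P] [Nonempty P]
    (H : ℕ) (hH : 0 < H)
    (q : P → Fin H → ℝ)
    (hq0 : ∀ π t, 0 ≤ q π t)
    (hq1 : ∀ π, ∑ t : Fin H, q π t ≤ 1)
    (p : P → ℝ) (hp : ∀ π, p π = ∑ t : Fin H, q π t)
    (L : P → ℝ)
    (hLdef : ∀ π, 0 < p π → L π = (∑ t : Fin H, ((t : ℕ) + 1 : ℝ) * q π t) / p π)
    (J : ℝ → P → ℝ)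
    (hJ : ∀ γ π, J γ π = ∑ t : Fin H, γ ^ (t : ℕ) * q π t)
    (πs : P)
    (hbw : ∃ γ₀ : ℝ, 0 ≤ γ₀ ∧ γ₀ < 1 ∧
      ∀ γ : ℝ, γ₀ ≤ γ → γ < 1 → ∀ π' : P, J γ πs ≥ J γ π') :
    (∀ π : P, p πs ≥ p π) ∧
    ((∃ π : P, 0 < p π) → ∀ π : P, p π = p πs → L πs ≤ L π) := by
  obtain ⟨γ₀, -, hγ₀, hopt⟩ := hbw
  have hderiv : ∀ π, HasDerivAt (fun γ => J γ π) (∑ t : Fin H, ((t : ℕ) : ℝ) * q π t) 1 := by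
    intro π
    simpa only [hJ] using hasDerivAt_sum_pow_mul_one (q π)
  have hone : ∀ π, J 1 π = p π := fun π => by simp [hJ, hp]
  have hev : ∀ π, ∀ᶠ γ in nhdsWithin (1 : ℝ) (Set.Iio 1), J γ π ≤ J γ πs := by
    intro π
    filter_upwards [Ico_mem_nhdsLT hγ₀] with γ hγ
    exact hopt γ hγ.1 hγ.2 π
  have hmax : ∀ π, p πs ≥ p π := by
    intro π
    have hlim := fun π => (hderiv π).continuousAt.tendsto.mono_left
      (nhdsWithin_le_nhds (s := Set.Iio (1 : ℝ)))
    simpa only [hone] using le_of_tendsto_of_tendsto (hlim π) (hlim πs) (hev π)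
  refine ⟨hmax, ?_⟩
  rintro ⟨π₀, hπ₀⟩ π hπ
  have hpos : 0 < p πs := hπ₀.trans_le (hmax π₀)
  have hle : ∑ t : Fin H, ((t : ℕ) : ℝ) * q πs t - ∑ t : Fin H, ((t : ℕ) : ℝ) * q π t ≤ 0 := by
    refine ((hderiv πs).fun_sub (hderiv π)).nonpos_of_eventually_nonneg_left ?_ ?_
    · simp only [hone, hπ, sub_self]
    · filter_upwards [hev π] with γ hγ
      exact sub_nonneg.2 hγ
  have hlen : ∀ π, ∑ t : Fin H, ((t : ℕ) + 1 : ℝ) * q π t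
      = ∑ t : Fin H, ((t : ℕ) : ℝ) * q π t + p π := by
    intro π
    simp only [hp, add_mul, one_mul, Finset.sum_add_distrib]
  rw [hLdef πs hpos, hLdef π (hπ ▸ hpos), hπ, hlen, hlen, hπ]
  exact div_le_div_of_nonneg_right (by linarith) hpos.le
end

section
/- There exists γ' ∈ [0,1) such that for every γ with γ' < γ < 1, every γ-discount-optimal policy π (one satisfying J γ π ≥ J γ π' for all π' ∈ Π) is a shortest-path policy: p π ≥ p π' for every π' ∈ Π, and if max_{π'' ∈ Π} p π'' > 0 then L π ≤ L π'' for every π'' ∈ Π with p π'' = p π. (For γ sufficiently close to 1, γ-discounted optimal policies are shortest successful-path policies.) -/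
open Filter Topology in
theorem eventually_pos_sum_pow_mul_of_sum_pos {H : ℕ} (a : Fin H → ℝ) (ha : 0 < ∑ t, a t) :
    ∀ᶠ γ : ℝ in 𝓝[<] 1, 0 < ∑ t : Fin H, γ ^ (t : ℕ) * a t := by
  have hc : Continuous fun γ : ℝ => ∑ t : Fin H, γ ^ (t : ℕ) * a t := by fun_prop
  exact (hc.continuousAt.mono_left nhdsWithin_le_nhds).eventually_const_lt (by simpa using ha)

open Filter Topology in
theorem HasDerivAt.eventually_pos_nhdsLT_of_neg {f : ℝ → ℝ} {d x : ℝ} (hf : HasDerivAt f d x)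
    (hx : f x = 0) (hd : d < 0) : ∀ᶠ y in 𝓝[<] x, 0 < f y := by
  have hs := (hasDerivAt_iff_tendsto_slope.1 hf).mono_left
    (nhdsWithin_mono x fun y (hy : y < x) => hy.ne)
  filter_upwards [hs.eventually_lt_const hd, self_mem_nhdsWithin] with y hy hyx
  rw [slope_def_field, hx, sub_zero] at hy
  have hyx' : y - x < 0 := sub_neg.2 hyx
  rcases div_neg_iff.1 hy with h | h
  · exact h.1
  · exact absurd h.2 hyx'.not_gt

open Filter Topology in
theorem eventually_pos_sum_pow_mul_of_sum_eq_zero {H : ℕ} (a : Fin H → ℝ) (ha : ∑ t, a t = 0)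
    (ha' : ∑ t : Fin H, ((t : ℕ) : ℝ) * a t < 0) :
    ∀ᶠ γ : ℝ in 𝓝[<] 1, 0 < ∑ t : Fin H, γ ^ (t : ℕ) * a t := by
  have hd : HasDerivAt (fun γ : ℝ => ∑ t : Fin H, γ ^ (t : ℕ) * a t)
      (∑ t : Fin H, ((t : ℕ) : ℝ) * a t) 1 := by
    refine HasDerivAt.fun_sum fun t _ => ?_
    simpa using (hasDerivAt_pow (t : ℕ) (1 : ℝ)).mul_const (a t)
  exact hd.eventually_pos_nhdsLT_of_neg (by simpa using ha) ha'


/-- For `γ` sufficiently close to `1`, every `γ`-discount-optimal policy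
is a shortest successful-path policy: it maximizes the success probability `p` and,
when the maximal success probability is positive, it minimizes the conditional
successful-path length `L` among success-probability maximizers. -/
theorem stmt6
    (P : Type*) [Fintype P] [Nonempty P]
    (H : ℕ) (hH : 0 < H)
    (q : P → Fin H → ℝ)
    (hq0 : ∀ π t, 0 ≤ q π t)
    (hq1 : ∀ π, ∑ t : Fin H, q π t ≤ 1)
    (p : P → ℝ) (hp : ∀ π, p π = ∑ t : Fin H, q π t)
    (L : P → ℝ)
    (hLdef : ∀ π, 0 < p π → L π = (∑ t : Fin H, ((t : ℕ) + 1 : ℝ) * q π t) / p π)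
    (J : ℝ → P → ℝ)
    (hJ : ∀ γ π, J γ π = ∑ t : Fin H, γ ^ (t : ℕ) * q π t) :
    ∃ γ' : ℝ, 0 ≤ γ' ∧ γ' < 1 ∧
      ∀ γ : ℝ, γ' < γ → γ < 1 →
        ∀ π : P, (∀ π' : P, J γ π ≥ J γ π') →
          (∀ π' : P, p π ≥ p π') ∧
          ((∃ π'' : P, 0 < p π'') → ∀ π'' : P, p π'' = p π → L π ≤ L π'') := by
  have hJsub (γ : ℝ) (π π' : P) :
      ∑ t : Fin H, γ ^ (t : ℕ) * (q π' t - q π t) = J γ π' - J γ π := by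
    simp only [hJ, mul_sub, Finset.sum_sub_distrib]
  have hpsub (π π' : P) : ∑ t : Fin H, (q π' t - q π t) = p π' - p π := by
    simp only [hp, Finset.sum_sub_distrib]
  have hev : ∀ᶠ γ : ℝ in nhdsWithin 1 (Set.Iio 1), ∀ π π' : P,
      (p π < p π' → J γ π < J γ π') ∧
      (p π' = p π → ∑ t : Fin H, ((t : ℕ) + 1 : ℝ) * q π' t <
        ∑ t : Fin H, ((t : ℕ) + 1 : ℝ) * q π t → J γ π < J γ π') := by
    refine Filter.eventually_all.2 fun π => Filter.eventually_all.2 fun π' =>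
      Filter.Eventually.and ?_ ?_
    · by_cases h : p π < p π'
      · filter_upwards [eventually_pos_sum_pow_mul_of_sum_pos (fun t => q π' t - q π t)
          (by rw [hpsub]; exact sub_pos.2 h)] with γ hγ _
        rw [hJsub] at hγ
        exact sub_pos.1 hγ
      · exact Filter.Eventually.of_forall fun _ h' => absurd h' h
    · by_cases h : p π' = p π ∧ ∑ t : Fin H, ((t : ℕ) + 1 : ℝ) * q π' t <
        ∑ t : Fin H, ((t : ℕ) + 1 : ℝ) * q π t
      · obtain ⟨he, hlt⟩ := h
        have hneg : ∑ t : Fin H, ((t : ℕ) : ℝ) * (q π' t - q π t) < 0 := by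
          simp only [add_mul, one_mul, Finset.sum_add_distrib, ← hp] at hlt
          simp only [mul_sub, Finset.sum_sub_distrib]
          linarith
        filter_upwards [eventually_pos_sum_pow_mul_of_sum_eq_zero (fun t => q π' t - q π t)
          (by rw [hpsub]; exact sub_eq_zero.2 he) hneg] with γ hγ _ _
        rw [hJsub] at hγ
        exact sub_pos.1 hγ
      · exact Filter.Eventually.of_forall fun _ he hlt => absurd ⟨he, hlt⟩ h
  obtain ⟨l, hl, hsub⟩ := (mem_nhdsLT_iff_exists_mem_Ico_Ioo_subset zero_lt_one).1 hev
  refine ⟨l, hl.1, hl.2, fun γ hlγ hγ π hopt => ?_⟩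
  have hγ' := hsub ⟨hlγ, hγ⟩
  have hmax (π' : P) : p π' ≤ p π :=
    not_lt.1 fun h => ((hγ' π π').1 h).not_ge (hopt π')
  refine ⟨hmax, fun ⟨π₀, h₀⟩ π' he => ?_⟩
  have hpos : 0 < p π := h₀.trans_le (hmax π₀)
  rw [hLdef π hpos, hLdef π' (he ▸ hpos), he]
  exact div_le_div_of_nonneg_right
    (not_lt.1 fun h => ((hγ' π π').2 he h).not_ge (hopt π')) hpos.le
end

section
/- For every π ∈ Π with p π > 0 and every ε ∈ [0,1], the discounted return at γ = 1 − ε satisfies the first-order expansion |J (1−ε) π − p π · (1 − ε·(L π − 1))| ≤ C_H · ε², where C_H = (H−1)·(H−2)/2. -/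
theorem Nat.cast_mul_cast_sub_one_nonneg (n : ℕ) : 0 ≤ (n : ℝ) * ((n : ℝ) - 1) := by
  rcases Nat.eq_zero_or_pos n with rfl | h
  · simp
  · have : (1 : ℝ) ≤ n := by exact_mod_cast h
    exact mul_nonneg (by linarith) (by linarith)

theorem one_sub_pow_le_quadratic {ε : ℝ} (h0 : 0 ≤ ε) (h1 : ε ≤ 1) (n : ℕ) :
    (1 - ε) ^ n ≤ 1 - n * ε + n * ((n : ℝ) - 1) / 2 * ε ^ 2 := by
  induction n with
  | zero => simp
  | succ n ih =>
    have h := mul_le_mul_of_nonneg_right ih (sub_nonneg.2 h1)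
    have h3 := mul_nonneg (Nat.cast_mul_cast_sub_one_nonneg n) (pow_nonneg h0 3)
    rw [pow_succ]
    push_cast
    nlinarith

theorem one_sub_mul_le_one_sub_pow {ε : ℝ} (h1 : ε ≤ 1) (n : ℕ) :
    1 - n * ε ≤ (1 - ε) ^ n := by
  have h := one_add_mul_le_pow (a := -ε) (by linarith) n
  rw [← sub_eq_add_neg] at h
  linarith

theorem Nat.cast_mul_cast_sub_one_le_of_lt {n m : ℕ} (h : n < m) :
    (n : ℝ) * ((n : ℝ) - 1) ≤ ((m : ℝ) - 1) * ((m : ℝ) - 2) := by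
  obtain ⟨k, rfl⟩ := Nat.exists_eq_add_of_lt h
  have hk := Nat.cast_mul_cast_sub_one_nonneg k
  have hnk : (0 : ℝ) ≤ n * k := by positivity
  push_cast
  nlinarith

/-- First-order expansion of the discounted return at `γ = 1 − ε`:
`|J (1−ε) π − p π (1 − ε (L π − 1))| ≤ C_H ε²` with `C_H = (H−1)(H−2)/2`. -/
theorem stmt7
    (P : Type*) [Fintype P] [Nonempty P]
    (H : ℕ) (hH : 0 < H)
    (q : P → Fin H → ℝ)
    (hq0 : ∀ π t, 0 ≤ q π t)
    (hq1 : ∀ π, ∑ t : Fin H, q π t ≤ 1)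
    (p : P → ℝ) (hp : ∀ π, p π = ∑ t : Fin H, q π t)
    (L : P → ℝ)
    (hLdef : ∀ π, 0 < p π → L π = (∑ t : Fin H, ((t : ℕ) + 1 : ℝ) * q π t) / p π)
    (J : ℝ → P → ℝ)
    (hJ : ∀ γ π, J γ π = ∑ t : Fin H, γ ^ (t : ℕ) * q π t) :
    ∀ π : P, 0 < p π → ∀ ε : ℝ, 0 ≤ ε → ε ≤ 1 →
      |J (1 - ε) π - p π * (1 - ε * (L π - 1))| ≤
        ((H : ℝ) - 1) * ((H : ℝ) - 2) / 2 * ε ^ 2 := by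
  intro π hπ ε h0 h1
  have hL : p π * L π = ∑ t : Fin H, ((t : ℕ) + 1 : ℝ) * q π t := by
    rw [hLdef π hπ, mul_div_cancel₀ _ hπ.ne']
  have key : J (1 - ε) π - p π * (1 - ε * (L π - 1)) =
      ∑ t : Fin H, ((1 - ε) ^ (t : ℕ) - (1 - (t : ℕ) * ε)) * q π t := by
    have e : p π * (1 - ε * (L π - 1)) = (1 + ε) * p π - ε * (p π * L π) := by ring
    rw [e, hL, hJ, hp, Finset.mul_sum, Finset.mul_sum, ← Finset.sum_sub_distrib,
      ← Finset.sum_sub_distrib]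
    exact Finset.sum_congr rfl fun t _ => by ring
  have hC : 0 ≤ ((H : ℝ) - 1) * ((H : ℝ) - 2) / 2 * ε ^ 2 := by
    have h := Nat.cast_mul_cast_sub_one_le_of_lt hH
    rw [Nat.cast_zero, zero_mul] at h
    positivity
  rw [key, abs_of_nonneg (Finset.sum_nonneg fun (t : Fin H) _ =>
    mul_nonneg (sub_nonneg.2 (one_sub_mul_le_one_sub_pow h1 t)) (hq0 π t))]
  calc ∑ t : Fin H, ((1 - ε) ^ (t : ℕ) - (1 - (t : ℕ) * ε)) * q π t
      ≤ ∑ t : Fin H, ((H : ℝ) - 1) * ((H : ℝ) - 2) / 2 * ε ^ 2 * q π t := by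
        refine Finset.sum_le_sum fun t _ => mul_le_mul_of_nonneg_right ?_ (hq0 π t)
        have hu := one_sub_pow_le_quadratic h0 h1 (t : ℕ)
        have hm := mul_le_mul_of_nonneg_right (Nat.cast_mul_cast_sub_one_le_of_lt t.isLt)
          (sq_nonneg ε)
        linarith
    _ = ((H : ℝ) - 1) * ((H : ℝ) - 2) / 2 * ε ^ 2 * ∑ t : Fin H, q π t := by
        rw [Finset.mul_sum]
    _ ≤ ((H : ℝ) - 1) * ((H : ℝ) - 2) / 2 * ε ^ 2 := mul_le_of_le_one_right hC (hq1 π)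
end

section
/- Let P be a row-stochastic matrix in Matrix S S ℝ (all entries nonnegative, each row summing to 1) over a nonempty finite type S, and let γ ∈ [0,1). Then det(1 − γ • P) > 0; in particular the matrix 1 − γ • P is invertible. -/
open Matrix

/-- For a row-stochastic matrix `P` and `t ∈ [0,1)`, the matrix `1 - t • P` is strictly
diagonally dominant, hence has nonzero determinant. -/
theorem det_one_sub_smul_ne_zero_of_row_stochastic {S : Type*} [Fintype S] [DecidableEq S]
    {P : Matrix S S ℝ} (hP : ∀ i j, 0 ≤ P i j) (hrow : ∀ i, ∑ j, P i j = 1)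
    {t : ℝ} (ht0 : 0 ≤ t) (ht1 : t < 1) :
    ((1 : Matrix S S ℝ) - t • P).det ≠ 0 := by
  refine det_ne_zero_of_sum_row_lt_diag fun k => ?_
  have hoff : ∑ j ∈ Finset.univ.erase k, ‖((1 : Matrix S S ℝ) - t • P) k j‖ =
      t * ∑ j ∈ Finset.univ.erase k, P k j := by
    rw [Finset.mul_sum]
    refine Finset.sum_congr rfl fun j hj => ?_
    rw [Matrix.sub_apply, Matrix.one_apply_ne (Finset.ne_of_mem_erase hj).symm,
      Matrix.smul_apply, smul_eq_mul, zero_sub, norm_neg, Real.norm_eq_abs,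
      abs_of_nonneg (mul_nonneg ht0 (hP k j))]
  have hsum := Finset.add_sum_erase Finset.univ (P k) (Finset.mem_univ k)
  rw [hrow k] at hsum
  have hdiag : 1 - t * P k k ≤ ‖((1 : Matrix S S ℝ) - t • P) k k‖ := by
    simpa using le_abs_self (1 - t * P k k)
  rw [hoff]
  refine lt_of_lt_of_le ?_ hdiag
  calc t * ∑ j ∈ Finset.univ.erase k, P k j = t - t * P k k := by
        linear_combination t * hsum
    _ < 1 - t * P k k := by linarith

/-- For a row-stochastic matrix `P` over a nonempty finite type and
`γ ∈ [0,1)`, the determinant `det (1 − γ • P)` is positive; in particular the matrix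
`1 − γ • P` is invertible. -/
theorem stmt10
    (S : Type*) [Fintype S] [Nonempty S] [DecidableEq S]
    (P : Matrix S S ℝ)
    (hstoch : ∀ s s', 0 ≤ P s s')
    (hrow : ∀ s, ∑ s', P s s' = 1)
    (γ : ℝ) (hγ0 : 0 ≤ γ) (hγ1 : γ < 1) :
    0 < ((1 : Matrix S S ℝ) - γ • P).det ∧ IsUnit ((1 : Matrix S S ℝ) - γ • P) := by
  have hpos : 0 < ((1 : Matrix S S ℝ) - γ • P).det := by
    by_contra! hle
    have hcont : Continuous fun t : ℝ => ((1 : Matrix S S ℝ) - t • P).det := by fun_prop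
    obtain ⟨t, ht, hzero⟩ := intermediate_value_Icc' hγ0 hcont.continuousOn
      (show (0 : ℝ) ∈ Set.Icc _ _ from ⟨hle, by simp⟩)
    exact det_one_sub_smul_ne_zero_of_row_stochastic hstoch hrow ht.1
      (ht.2.trans_lt hγ1) hzero
  exact ⟨hpos, (Matrix.isUnit_iff_isUnit_det _).2 hpos.ne'.isUnit⟩
end
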